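/- (Corollary 1) Let M be a multi-agent MDP with n agents such that for every agent i and every fixed π_{-i} the projection Π_i(M,π_{-i}) has a unique optimal policy. Then for every permutation σ of {1,…,n} and every initial joint policy π, there exists N ∈ ℕ such that the N-fold iterate JR_σ^N(π) is a Nash equilibrium; moreover JR_σ^g(π) = JR_σ^N(π) for all g ≥ N (convergence is achieved in finite time). -/

import Mathlib

open scoped ENNReal

/-- A (finite) Markov Decision Process with states `S`, actions `A`,
transition kernel `T`, reward `R` and discount factor `γ ∈ [0,1)`. -/
structure MDP (S A : Type) [Fintype S] [Nonempty S] [Fintype A] [Nonempty A] where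
  T : S → A → PMF S
  R : S → A → ℝ
  γ : ℝ
  γ_nonneg : 0 ≤ γ
  γ_lt_one : γ < 1

namespace MDP

variable {S A : Type} [Fintype S] [Nonempty S] [Fintype A] [Nonempty A]

/-- The distribution of the state at time `t` of the Markov chain induced by
policy `π`, started at `s₀`. -/
noncomputable def stateDist (M : MDP S A) (π : S → A) (s₀ : S) : ℕ → PMF S
  | 0 => PMF.pure s₀
  | t + 1 => (M.stateDist π s₀ t).bind fun s => M.T s (π s)

/-- The value of policy `π` at state `s₀`:
`V^{M,π}(s₀) = ∑_{t≥0} γ^t E[R(s_t, π(s_t))]`. -/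
noncomputable def V (M : MDP S A) (π : S → A) (s₀ : S) : ℝ :=
  ∑' t : ℕ, M.γ ^ t * ∑ s : S, ((M.stateDist π s₀ t) s).toReal * M.R s (π s)

/-- A policy `ρ` is optimal for `M` if it dominates every policy at every state. -/
def Optimal (M : MDP S A) (ρ : S → A) : Prop :=
  ∀ (ρ' : S → A) (s : S), M.V ρ' s ≤ M.V ρ s

end MDP

section MMDP

variable {S : Type} [Fintype S] [Nonempty S]
variable {n : ℕ} {A : Fin n → Type} [∀ i, Fintype (A i)] [∀ i, Nonempty (A i)]

/-- A joint policy `(π₁,…,π_n)` regarded as a single policy over joint actions. -/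
def toPolicy (π : ∀ i, S → A i) : S → ∀ i, A i := fun s i => π i s

/-- The `i`-th self-absorbed projection `Π_i(M, π_{-i})`: the single agent MDP for
agent `i` when the other agents act according to `π_{-i}`. -/
noncomputable def proj (M : MDP S (∀ i, A i)) (i : Fin n) (π : ∀ j, S → A j) :
    MDP S (A i) where
  T := fun s a => M.T s (Function.update (fun j => π j s) i a)
  R := fun s a => M.R s (Function.update (fun j => π j s) i a)
  γ := M.γ
  γ_nonneg := M.γ_nonneg
  γ_lt_one := M.γ_lt_one

/-- Given that each projection has a unique optimal policy, the `i`-th best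
response operator replaces agent `i`'s policy by the optimal policy of
`Π_i(M, π_{-i})`. -/
noncomputable def BR (M : MDP S (∀ i, A i))
    (hU : ∀ (i : Fin n) (π : ∀ j, S → A j), ∃! ρ : S → A i, (proj M i π).Optimal ρ)
    (i : Fin n) (π : ∀ j, S → A j) : ∀ j, S → A j :=
  Function.update π i (hU i π).choose

/-- A joint policy `π` is a Nash equilibrium if no unilateral deviation of a single
agent can increase the value at any state. -/
def Nash (M : MDP S (∀ i, A i)) (π : ∀ j, S → A j) : Prop :=
  ∀ (i : Fin n) (π' : S → A i) (s : S),
    M.V (toPolicy (Function.update π i π')) s ≤ M.V (toPolicy π) s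

/-- The joint response operator `JR_σ = BR_{σ(n)} ∘ ⋯ ∘ BR_{σ(1)}`. -/
noncomputable def JR (M : MDP S (∀ i, A i))
    (hU : ∀ (i : Fin n) (π : ∀ j, S → A j), ∃! ρ : S → A i, (proj M i π).Optimal ρ)
    (σ : Equiv.Perm (Fin n)) (π : ∀ j, S → A j) : ∀ j, S → A j :=
  (List.finRange n).foldl (fun p k => BR M hU (σ k) p) π

end MMDP

theorem toPolicy_update {S : Type} {n : ℕ} {A : Fin n → Type}
    (π : ∀ j, S → A j) (i : Fin n) (ρ : S → A i) (s : S) :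
    toPolicy (Function.update π i ρ) s = Function.update (fun j => π j s) i (ρ s) := by
  funext j
  by_cases h : j = i
  · subst h
    simp [toPolicy]
  · simp [toPolicy, h]

section BestResponse

variable {S : Type} [Fintype S] [Nonempty S]
variable {n : ℕ} {A : Fin n → Type} [∀ i, Fintype (A i)] [∀ i, Nonempty (A i)]

theorem proj_stateDist (M : MDP S (∀ i, A i)) (i : Fin n) (π : ∀ j, S → A j)
    (ρ : S → A i) (s : S) (t : ℕ) :
    (proj M i π).stateDist ρ s t = M.stateDist (toPolicy (Function.update π i ρ)) s t := by
  induction t with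
  | zero => rfl
  | succ t ih =>
    simp only [MDP.stateDist, ih, toPolicy_update]
    rfl

/-- The value of a policy in the projection is the value of the joint policy in which
agent `i` plays it. -/
theorem proj_V (M : MDP S (∀ i, A i)) (i : Fin n) (π : ∀ j, S → A j)
    (ρ : S → A i) (s : S) :
    (proj M i π).V ρ s = M.V (toPolicy (Function.update π i ρ)) s := by
  simp only [MDP.V, proj_stateDist, toPolicy_update]
  rfl

theorem proj_V_self (M : MDP S (∀ i, A i)) (i : Fin n) (π : ∀ j, S → A j) (s : S) :
    (proj M i π).V (π i) s = M.V (toPolicy π) s := by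
  rw [proj_V, Function.update_eq_self]

/-- The total value of a joint policy, summed over all starting states. -/
noncomputable def totalValue (M : MDP S (∀ i, A i)) (π : ∀ j, S → A j) : ℝ :=
  ∑ s, M.V (toPolicy π) s

variable (M : MDP S (∀ i, A i))
  (hU : ∀ (i : Fin n) (π : ∀ j, S → A j), ∃! ρ : S → A i, (proj M i π).Optimal ρ)

theorem V_le_V_BR (i : Fin n) (π : ∀ j, S → A j) (s : S) :
    M.V (toPolicy π) s ≤ M.V (toPolicy (BR M hU i π)) s := by
  rw [← proj_V_self M i π, BR, ← proj_V]
  exact (hU i π).choose_spec.1 (π i) s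

theorem BR_eq_self_of_optimal {i : Fin n} {π : ∀ j, S → A j}
    (h : (proj M i π).Optimal (π i)) : BR M hU i π = π := by
  rw [BR, ← (hU i π).choose_spec.2 _ h, Function.update_eq_self]

theorem totalValue_le_BR (i : Fin n) (π : ∀ j, S → A j) :
    totalValue M π ≤ totalValue M (BR M hU i π) :=
  Finset.sum_le_sum fun s _ => V_le_V_BR M hU i π s

theorem BR_eq_self_of_totalValue_le {i : Fin n} {π : ∀ j, S → A j}
    (h : totalValue M (BR M hU i π) ≤ totalValue M π) : BR M hU i π = π := by
  have hV := (Finset.sum_eq_sum_iff_of_le fun s _ => V_le_V_BR M hU i π s).1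
    (le_antisymm (totalValue_le_BR M hU i π) h)
  refine BR_eq_self_of_optimal M hU fun ρ s => ?_
  rw [proj_V_self, hV s (Finset.mem_univ s), BR, ← proj_V]
  exact (hU i π).choose_spec.1 ρ s

theorem nash_of_BR_eq_self {π : ∀ j, S → A j} (h : ∀ i, BR M hU i π = π) : Nash M π := by
  intro i ρ s
  rw [← h i, BR, Function.update_idem, ← proj_V, ← proj_V]
  exact (hU i π).choose_spec.1 ρ s

theorem totalValue_le_foldl_BR (l : List (Fin n)) (σ : Equiv.Perm (Fin n))
    (π : ∀ j, S → A j) :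
    totalValue M π ≤ totalValue M (l.foldl (fun p k => BR M hU (σ k) p) π) := by
  induction l generalizing π with
  | nil => exact le_rfl
  | cons k l ih => exact (totalValue_le_BR M hU (σ k) π).trans (ih _)

theorem BR_eq_self_of_totalValue_foldl_le (l : List (Fin n)) (σ : Equiv.Perm (Fin n))
    (π : ∀ j, S → A j)
    (h : totalValue M (l.foldl (fun p k => BR M hU (σ k) p) π) ≤ totalValue M π) :
    ∀ k ∈ l, BR M hU (σ k) π = π := by
  induction l with
  | nil => simp
  | cons k l ih =>
    have hk : BR M hU (σ k) π = π :=
      BR_eq_self_of_totalValue_le M hU ((totalValue_le_foldl_BR M hU l σ _).trans h)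
    rw [List.foldl_cons, hk] at h
    exact List.forall_mem_cons.2 ⟨hk, ih h⟩

theorem foldl_BR_eq_self (l : List (Fin n)) (σ : Equiv.Perm (Fin n)) {π : ∀ j, S → A j}
    (h : ∀ i, BR M hU i π = π) : l.foldl (fun p k => BR M hU (σ k) p) π = π := by
  induction l with
  | nil => rfl
  | cons k l ih => rw [List.foldl_cons, h, ih]

end BestResponse

/-- Corollary 1: for every permutation `σ` and every initial joint
policy `π`, iterating the joint response `JR_σ` converges in finite time to a Nash
equilibrium. -/
theorem JR_iterate_converges_to_nash
    {S : Type} [Fintype S] [Nonempty S] {n : ℕ} {A : Fin n → Type}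
    [∀ i, Fintype (A i)] [∀ i, Nonempty (A i)]
    (M : MDP S (∀ i, A i))
    (hU : ∀ (i : Fin n) (π : ∀ j, S → A j), ∃! ρ : S → A i, (proj M i π).Optimal ρ)
    (σ : Equiv.Perm (Fin n)) (π : ∀ j, S → A j) :
    ∃ N : ℕ, Nash M ((JR M hU σ)^[N] π) ∧
      ∀ g : ℕ, N ≤ g → (JR M hU σ)^[g] π = (JR M hU σ)^[N] π := by
  obtain ⟨N, hN⟩ : ∃ N : ℕ, ∀ g : ℕ,
      totalValue M ((JR M hU σ)^[g] π) ≤ totalValue M ((JR M hU σ)^[N] π) := by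
    have hfin : (Set.range fun g : ℕ => (JR M hU σ)^[g] π).Finite := Set.toFinite _
    obtain ⟨_, ⟨N, rfl⟩, hN⟩ :=
      Set.exists_max_image _ (totalValue M) hfin (Set.range_nonempty _)
    exact ⟨N, fun g => hN _ ⟨g, rfl⟩⟩
  have hBR : ∀ i, BR M hU i ((JR M hU σ)^[N] π) = (JR M hU σ)^[N] π := by
    intro i
    have hle := hN (N + 1)
    rw [Function.iterate_succ_apply'] at hle
    simpa using BR_eq_self_of_totalValue_foldl_le M hU (List.finRange n) σ _ hle
      (σ.symm i) (List.mem_finRange _)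
  refine ⟨N, nash_of_BR_eq_self M hU hBR, fun g hg => ?_⟩
  obtain ⟨k, rfl⟩ := Nat.exists_eq_add_of_le' hg
  rw [Function.iterate_add_apply]
  exact Function.iterate_fixed (foldl_BR_eq_self M hU (List.finRange n) σ hBR) k
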